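/- There exists a planar simple graph on 9 vertices with 18 edges that contains no cycle of length 6 as a subgraph (namely, two copies of K₅ minus an edge sharing one vertex). Consequently ex_P(9, C₆) = 18 = 18(9−2)/7, so the bound ex_P(n, C₆) ≤ 18(n−2)/7 is attained with equality at n = 9. -/

import Mathlib

open SimpleGraph

/-- `G` has a planar embedding (drawing in the plane): vertices are mapped to distinct
points of `ℝ²`, each edge `uv` is drawn as a simple continuous arc from the point of `u`
to the point of `v`, arcs traversed in opposite directions coincide, the interior of an
arc passes through no vertex point, and the interiors of arcs of distinct edges are
disjoint. -/
def SimpleGraph.HasPlanarEmbedding {V : Type*} (G : SimpleGraph V) : Prop :=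
  ∃ (pos : V → ℝ × ℝ) (arc : V → V → ℝ → ℝ × ℝ),
    Function.Injective pos ∧
    (∀ u v : V, G.Adj u v →
      ContinuousOn (arc u v) (Set.Icc (0 : ℝ) 1) ∧
      Set.InjOn (arc u v) (Set.Icc (0 : ℝ) 1) ∧
      arc u v 0 = pos u ∧
      arc u v 1 = pos v ∧
      (∀ t : ℝ, arc u v t = arc v u (1 - t)) ∧
      (∀ w : V, ∀ t ∈ Set.Ioo (0 : ℝ) 1, arc u v t ≠ pos w)) ∧
    (∀ u v x y : V, G.Adj u v → G.Adj x y → s(u, v) ≠ s(x, y) →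
      ∀ t₁ ∈ Set.Ioo (0 : ℝ) 1, ∀ t₂ ∈ Set.Ioo (0 : ℝ) 1, arc u v t₁ ≠ arc x y t₂)

/-- `G` contains a subgraph isomorphic to `F`, i.e. there is an injective graph
homomorphism from `F` to `G`. -/
def ContainsCopy {α β : Type*} (F : SimpleGraph α) (G : SimpleGraph β) : Prop :=
  ∃ f : F →g G, Function.Injective f

/-- The Theta graph on 4 vertices: the 4-cycle 0-1-2-3-0 plus the chord 02,
i.e. `K₄` minus one edge. -/
def theta4 : SimpleGraph (Fin 4) :=
  SimpleGraph.fromEdgeSet {s(0, 1), s(1, 2), s(2, 3), s(0, 3), s(0, 2)}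

/-- The Theta graph on 5 vertices: the 5-cycle 0-1-2-3-4-0 plus the chord 02. -/
def theta5 : SimpleGraph (Fin 5) :=
  SimpleGraph.fromEdgeSet {s(0, 1), s(1, 2), s(2, 3), s(3, 4), s(0, 4), s(0, 2)}

/-- The cycle on 6 vertices: 0-1-2-3-4-5-0. -/
def cycle6 : SimpleGraph (Fin 6) :=
  SimpleGraph.fromEdgeSet {s(0, 1), s(1, 2), s(2, 3), s(3, 4), s(4, 5), s(0, 5)}

/-- `G` contains no member of `Θ₆` as a subgraph: for each pair of distinct
non-consecutive vertices `a`, `b` of the 6-cycle, `G` contains no copy of the Theta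
graph obtained from the 6-cycle by adding the chord `ab`. -/
def Theta6Free {β : Type*} (G : SimpleGraph β) : Prop :=
  ∀ a b : Fin 6, a ≠ b → ¬ cycle6.Adj a b →
    ¬ ContainsCopy (cycle6 ⊔ SimpleGraph.fromEdgeSet {s(a, b)}) G

/-- `K₅⁻`: the complete graph on 5 vertices minus one edge. -/
def K5minus : SimpleGraph (Fin 5) :=
  (⊤ : SimpleGraph (Fin 5)).deleteEdges {s(0, 1)}

section Copies

variable {V : Type*} {G : SimpleGraph V}

theorem containsCopy_cycle6_of_adj {a b c d e x : V} (hn : [a, b, c, d, e, x].Nodup)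
    (hab : G.Adj a b) (hbc : G.Adj b c) (hcd : G.Adj c d) (hde : G.Adj d e) (hex : G.Adj e x)
    (hxa : G.Adj x a) : ContainsCopy cycle6 G := by
  refine ⟨⟨[a, b, c, d, e, x].get, ?_⟩, List.nodup_iff_injective_get.mp hn⟩
  intro i j hij
  simp only [cycle6, SimpleGraph.fromEdgeSet_adj, Set.mem_insert_iff, Set.mem_singleton_iff,
    Sym2.eq_iff] at hij
  have := hab.symm; have := hbc.symm; have := hcd.symm
  have := hde.symm; have := hex.symm; have := hxa.symm
  obtain ⟨h, -⟩ := hij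
  rcases h with (⟨rfl, rfl⟩ | ⟨rfl, rfl⟩) | (⟨rfl, rfl⟩ | ⟨rfl, rfl⟩) | (⟨rfl, rfl⟩ | ⟨rfl, rfl⟩) |
    (⟨rfl, rfl⟩ | ⟨rfl, rfl⟩) | (⟨rfl, rfl⟩ | ⟨rfl, rfl⟩) | (⟨rfl, rfl⟩ | ⟨rfl, rfl⟩) <;> assumption

theorem containsCopy_top_of_adj {a b c d e : V} (hab : G.Adj a b) (hac : G.Adj a c)
    (had : G.Adj a d) (hae : G.Adj a e) (hbc : G.Adj b c) (hbd : G.Adj b d) (hbe : G.Adj b e)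
    (hcd : G.Adj c d) (hce : G.Adj c e) (hde : G.Adj d e) :
    ContainsCopy (⊤ : SimpleGraph (Fin 5)) G := by
  have hadj : ∀ i j : Fin 5, i ≠ j → G.Adj (![a, b, c, d, e] i) (![a, b, c, d, e] j) := by
    intro i j hij
    fin_cases i <;> fin_cases j <;> first | exact absurd rfl hij | assumption |
      (apply SimpleGraph.Adj.symm; assumption)
  refine ⟨⟨![a, b, c, d, e], fun {i j} hij => hadj i j hij.ne⟩, fun i j hij => ?_⟩
  by_contra hne
  exact (hadj i j hne).ne hij

end Copies

section BitSets

/-- The number whose binary digits are the indicator function of `S`. -/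
def bitSum (S : Finset ℕ) : ℕ := ∑ i ∈ S, 2 ^ i

theorem testBit_bitSum (S : Finset ℕ) (i : ℕ) : (bitSum S).testBit i = decide (i ∈ S) := by
  rw [Bool.eq_iff_iff, decide_eq_true_iff, ← Nat.mem_bitIndices, ← List.mem_toFinset, bitSum,
    Finset.toFinset_bitIndices_sum_two_pow]

theorem bitSum_injective : Function.Injective bitSum := by
  intro S T h
  ext i
  simpa [testBit_bitSum] using congrArg (Nat.testBit · i) h

theorem bitSum_singleton (i : ℕ) : bitSum {i} = 2 ^ i := Finset.sum_singleton _ _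

theorem bitSum_insert {i : ℕ} {S : Finset ℕ} (h : i ∉ S) : bitSum (insert i S) = bitSum S + 2 ^ i := by
  rw [bitSum, Finset.sum_insert h, add_comm, bitSum]

theorem land_bitSum (S T : Finset ℕ) : Nat.land (bitSum S) (bitSum T) = bitSum (S ∩ T) := by
  apply Nat.eq_of_testBit_eq
  intro i
  change (bitSum S &&& bitSum T).testBit i = _
  simp [testBit_bitSum]

theorem bitSum_sdiff {S T : Finset ℕ} (h : T ⊆ S) : bitSum (S \ T) = bitSum S - bitSum T := by
  rw [bitSum, bitSum, bitSum, ← Finset.sum_sdiff h, Nat.add_sub_cancel]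

/-- Disjointness of sets coded as numbers. -/
def disjointBits (m n : ℕ) : Bool := Nat.beq (Nat.land m n) 0

theorem disjointBits_bitSum (S T : Finset ℕ) :
    disjointBits (bitSum S) (bitSum T) = decide (Disjoint S T) := by
  rw [Bool.eq_iff_iff, decide_eq_true_iff, disjointBits, Nat.beq_eq, land_bitSum,
    Finset.disjoint_iff_inter_eq_empty]
  exact ⟨fun h => bitSum_injective h, fun h => by rw [h]; rfl⟩

theorem disjointBits_bitSum_two_pow (S : Finset ℕ) (i : ℕ) :
    disjointBits (bitSum S) (2 ^ i) = !decide (i ∈ S) := by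
  rw [← bitSum_singleton, disjointBits_bitSum]
  simp

/-- All subsets of `{0, …, n - 1}`, as pairs consisting of the cardinality and the code. -/
def codedSubsets : ℕ → List (ℕ × ℕ)
  | 0 => [(0, 0)]
  | n + 1 => codedSubsets n ++ (codedSubsets n).map fun p => (p.1 + 1, p.2 + 2 ^ n)

theorem mem_codedSubsets {n : ℕ} {S : Finset ℕ} (h : S ⊆ Finset.range n) :
    (S.card, bitSum S) ∈ codedSubsets n := by
  induction n generalizing S with
  | zero =>
    obtain rfl : S = ∅ := by simpa using h
    simp [codedSubsets, bitSum]
  | succ n ih =>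
    rw [Finset.range_add_one] at h
    simp only [codedSubsets, List.mem_append, List.mem_map]
    by_cases hn : n ∈ S
    · right
      refine ⟨_, ih (Finset.subset_insert_iff.mp h), ?_⟩
      rw [Finset.card_erase_add_one hn, ← bitSum_insert (Finset.notMem_erase n S),
        Finset.insert_erase hn]
    · exact Or.inl (ih ((Finset.subset_insert_iff_of_notMem hn).mp h))

end BitSets

section Search

/-- A vertex of a coded graph: the singleton consisting of it, its neighbourhood, its degree. -/
structure CodedVertex where
  self : ℕ
  nbrs : ℕ
  deg : ℕ

/-- The pairs of vertices that are the ends of a path on five vertices. -/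
def pathFiveEnds (r : List CodedVertex) : List ℕ :=
  r.flatMap fun a => (r.filter fun e => Nat.blt a.self e.self &&
    r.any fun b => !disjointBits a.nbrs b.self && !Nat.beq b.self e.self &&
      r.any fun d => !disjointBits e.nbrs d.self && !Nat.beq d.self a.self &&
        !Nat.beq d.self b.self &&
        !disjointBits (Nat.land b.nbrs d.nbrs) (1023 - a.self - e.self)).map
    fun e => a.self + e.self

/-- The cliques on four vertices. -/
def fourCliques (r : List CodedVertex) : List ℕ :=
  r.flatMap fun a => (r.filter fun b =>
      Nat.blt a.self b.self && !disjointBits a.nbrs b.self).flatMap fun b =>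
    (r.filter fun c =>
      Nat.blt b.self c.self && !disjointBits (Nat.land a.nbrs b.nbrs) c.self).flatMap fun c =>
    (r.filter fun d => Nat.blt c.self d.self &&
      !disjointBits (Nat.land (Nat.land a.nbrs b.nbrs) c.nbrs) d.self).map fun d =>
    a.self + b.self + c.self + d.self

/-- Add vertex `n` with coded neighbourhood `m` of size `d`. -/
def insertVertex (n d m : ℕ) (r : List CodedVertex) : List CodedVertex :=
  ⟨2 ^ n, m, d⟩ :: r.map fun a =>
    bif disjointBits m a.self then a else ⟨a.self, a.nbrs + 2 ^ n, a.deg + 1⟩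

/-- Lower bounds for the degree sums of the successive induced subgraphs. -/
def degreeSumBound (n : ℕ) : ℕ := [0, 0, 2, 4, 8, 12, 18, 24, 30, 38].getD n 0

/-- The extensions of a coded graph by a vertex `n` of minimum degree which create neither a
6-cycle nor a clique on five vertices; the first component is the sum of the degrees. -/
def codedExtensions (n : ℕ) (s : ℕ × List CodedVertex) : List (ℕ × List CodedVertex) :=
  let F := pathFiveEnds s.2 ++ fourCliques s.2
  (((codedSubsets n).filter fun p => Nat.ble (degreeSumBound (n + 1)) (s.1 + 2 * p.1) &&
    F.all fun b => !Nat.beq (Nat.land p.2 b) b).map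
      fun p => (s.1 + 2 * p.1, insertVertex n p.1 p.2 s.2)).filter fun t =>
    match t.2 with
    | [] => true
    | v :: r => r.all fun a => Nat.ble v.deg a.deg

/-- The coded graphs on `n` vertices that are built by successive extensions. -/
def codedGraphs : ℕ → List (ℕ × List CodedVertex)
  | 0 => [(0, [])]
  | n + 1 => (codedGraphs n).flatMap (codedExtensions n)

set_option maxRecDepth 100000 in
theorem codedGraphs_nine : codedGraphs 9 = [] := by decide +kernel

end Search

section Ordering

variable {V : Type*} (G : SimpleGraph V) (f : ℕ → V)

open Classical in
/-- The neighbours of the `i`-th vertex among the first `k` vertices. -/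
noncomputable def nbrsBelow (k i : ℕ) : Finset ℕ := {j ∈ Finset.range k | G.Adj (f i) (f j)}

/-- The code of the `i`-th vertex in the graph induced on the first `k` vertices. -/
noncomputable def codedVertex (k i : ℕ) : CodedVertex :=
  ⟨2 ^ i, bitSum (nbrsBelow G f k i), (nbrsBelow G f k i).card⟩

/-- The code of the graph induced on the first `k` vertices, last vertex first. -/
noncomputable def codedPrefix (k : ℕ) : List CodedVertex :=
  (List.range k).reverse.map (codedVertex G f k)

/-- The sum of the degrees in the graph induced on the first `k` vertices. -/
noncomputable def prefixDegreeSum (k : ℕ) : ℕ := ∑ i ∈ Finset.range k, (nbrsBelow G f k i).card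

variable {G f}

theorem mem_nbrsBelow {k i j : ℕ} : j ∈ nbrsBelow G f k i ↔ j < k ∧ G.Adj (f i) (f j) := by
  simp [nbrsBelow]

theorem mem_codedPrefix {k : ℕ} {a : CodedVertex} (h : a ∈ codedPrefix G f k) :
    ∃ i < k, a = codedVertex G f k i := by
  simp only [codedPrefix, List.mem_map, List.mem_reverse, List.mem_range] at h
  obtain ⟨i, hi, rfl⟩ := h
  exact ⟨i, hi, rfl⟩

theorem nbrsBelow_succ_self (k : ℕ) : nbrsBelow G f (k + 1) k = nbrsBelow G f k k := by
  ext j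
  simp only [mem_nbrsBelow]
  refine ⟨fun ⟨h, h'⟩ => ⟨lt_of_le_of_ne (Nat.lt_succ_iff.mp h) ?_, h'⟩, fun ⟨h, h'⟩ => ⟨by lia, h'⟩⟩
  rintro rfl
  exact h'.ne rfl

theorem nbrsBelow_succ_of_adj {k i : ℕ} (h : G.Adj (f i) (f k)) :
    nbrsBelow G f (k + 1) i = insert k (nbrsBelow G f k i) := by
  ext j
  simp only [mem_nbrsBelow, Finset.mem_insert]
  constructor
  · rintro ⟨h1, h2⟩
    by_cases hj : j = k
    · exact Or.inl hj
    · exact Or.inr ⟨by lia, h2⟩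
  · rintro (rfl | ⟨h1, h2⟩)
    · exact ⟨by lia, h⟩
    · exact ⟨by lia, h2⟩

theorem nbrsBelow_succ_of_not_adj {k i : ℕ} (h : ¬ G.Adj (f i) (f k)) :
    nbrsBelow G f (k + 1) i = nbrsBelow G f k i := by
  ext j
  simp only [mem_nbrsBelow]
  refine ⟨fun ⟨h1, h2⟩ => ⟨lt_of_le_of_ne (Nat.lt_succ_iff.mp h1) ?_, h2⟩, fun ⟨h1, h2⟩ => ⟨by lia, h2⟩⟩
  rintro rfl
  exact h h2

theorem notMem_nbrsBelow_self (k i : ℕ) : k ∉ nbrsBelow G f k i := by simp [mem_nbrsBelow]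

theorem prefixDegreeSum_succ (k : ℕ) :
    prefixDegreeSum G f (k + 1) = prefixDegreeSum G f k + 2 * (nbrsBelow G f k k).card := by
  classical
  have h : ∀ i ∈ Finset.range k, (nbrsBelow G f (k + 1) i).card =
      (nbrsBelow G f k i).card + if G.Adj (f k) (f i) then 1 else 0 := by
    intro i _
    by_cases hi : G.Adj (f k) (f i)
    · rw [nbrsBelow_succ_of_adj hi.symm, Finset.card_insert_of_notMem (notMem_nbrsBelow_self k i),
        if_pos hi]
    · rw [nbrsBelow_succ_of_not_adj fun h => hi h.symm, if_neg hi, add_zero]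
  rw [prefixDegreeSum, Finset.sum_range_succ, Finset.sum_congr rfl h, Finset.sum_add_distrib,
    ← Finset.card_filter, nbrsBelow_succ_self, prefixDegreeSum]
  simp only [nbrsBelow]
  lia

theorem codedPrefix_succ (k : ℕ) : codedPrefix G f (k + 1) =
    insertVertex k (nbrsBelow G f k k).card (bitSum (nbrsBelow G f k k)) (codedPrefix G f k) := by
  simp only [codedPrefix, insertVertex, List.range_succ, List.reverse_append, List.reverse_singleton,
    List.singleton_append, List.map_cons, List.map_map]
  congr 1
  · rw [codedVertex, nbrsBelow_succ_self]
  · refine List.map_congr_left fun i hi => ?_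
    have hik : i < k := by simpa using hi
    by_cases h : G.Adj (f k) (f i)
    · have hmem : i ∈ nbrsBelow G f k k := mem_nbrsBelow.mpr ⟨hik, h⟩
      simp [codedVertex, disjointBits_bitSum_two_pow, hmem, nbrsBelow_succ_of_adj h.symm,
        bitSum_insert (notMem_nbrsBelow_self k i),
        Finset.card_insert_of_notMem (notMem_nbrsBelow_self k i)]
    · have hmem : i ∉ nbrsBelow G f k k := fun h' => h (mem_nbrsBelow.mp h').2
      simp [codedVertex, disjointBits_bitSum_two_pow, hmem,
        nbrsBelow_succ_of_not_adj fun h' => h h'.symm]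

theorem containsCopy_cycle6_of_pathFiveEnds {k b : ℕ} (hk : k < 9)
    (hf : Set.InjOn f (Set.Iic k)) (hb : b ∈ pathFiveEnds (codedPrefix G f k))
    (h : Nat.land (bitSum (nbrsBelow G f k k)) b = b) : ContainsCopy cycle6 G := by
  simp only [pathFiveEnds, List.mem_flatMap, List.mem_map, List.mem_filter, Bool.and_eq_true,
    List.any_eq_true, Bool.not_eq_true'] at hb
  obtain ⟨_, ha, _, ⟨he, hae, _, hb, ⟨hab, hbe⟩, _, hd, ⟨⟨hed, hda⟩, hdb⟩, hc⟩, rfl⟩ := hb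
  obtain ⟨a, hak, rfl⟩ := mem_codedPrefix ha
  obtain ⟨b, hbk, rfl⟩ := mem_codedPrefix hb
  obtain ⟨d, hdk, rfl⟩ := mem_codedPrefix hd
  obtain ⟨e, hek, rfl⟩ := mem_codedPrefix he
  rw [← Bool.not_eq_true, Nat.beq_eq] at hbe hda hdb
  simp only [codedVertex, disjointBits_bitSum_two_pow, Bool.not_eq_false', decide_eq_true_iff,
    Nat.blt_eq, mem_nbrsBelow, land_bitSum, Nat.pow_right_injective le_rfl |>.eq_iff] at *
  have hae' : a ≠ e := by rintro rfl; exact lt_irrefl _ hae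
  have hpair : 2 ^ a + 2 ^ e = bitSum {e, a} := by
    rw [bitSum_insert (by simpa using hae'.symm), bitSum_singleton]
  have hcompl : 1023 - 2 ^ a - 2 ^ e = bitSum (Finset.range 10 \ {e, a}) := by
    rw [Nat.sub_sub, hpair, bitSum_sdiff]
    · rfl
    · intro i
      simp only [Finset.mem_insert, Finset.mem_singleton, Finset.mem_range]
      lia
  rw [hcompl, disjointBits_bitSum, decide_eq_false_iff_not, Finset.not_disjoint_iff] at hc
  obtain ⟨c, hc, hcae⟩ := hc
  simp only [Finset.mem_inter, mem_nbrsBelow, Finset.mem_sdiff, Finset.mem_insert,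
    Finset.mem_singleton, not_or] at hc hcae
  rw [hpair, land_bitSum, bitSum_injective.eq_iff, Finset.inter_eq_right, Finset.insert_subset_iff,
    Finset.singleton_subset_iff, mem_nbrsBelow, mem_nbrsBelow] at h
  refine containsCopy_cycle6_of_adj (a := f k) (b := f a) (c := f b) (d := f c) (e := f d)
    (x := f e) ?_ h.2.2 hab.2 hc.1.2 hc.2.2.symm hed.2.symm h.1.2.symm
  have hbc : b ≠ c := by rintro rfl; exact hc.1.2.ne rfl
  have hdc : d ≠ c := by rintro rfl; exact hc.2.2.ne rfl
  have hab' : a ≠ b := by rintro rfl; exact hab.2.ne rfl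
  have hde' : e ≠ d := by rintro rfl; exact hed.2.ne rfl
  have : [k, a, b, c, d, e].Nodup := by
    simp only [List.nodup_cons, List.mem_cons, List.not_mem_nil, or_false, not_or]
    grind
  refine this.map_on (f := f) fun x hx y hy hxy => hf ?_ ?_ hxy
  all_goals
    simp only [List.mem_cons, List.not_mem_nil, or_false, Set.mem_Iic] at *
    lia

theorem containsCopy_top_of_fourCliques {k b : ℕ} (hb : b ∈ fourCliques (codedPrefix G f k))
    (h : Nat.land (bitSum (nbrsBelow G f k k)) b = b) :
    ContainsCopy (⊤ : SimpleGraph (Fin 5)) G := by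
  simp only [fourCliques, List.mem_flatMap, List.mem_map, List.mem_filter, Bool.and_eq_true,
    Bool.not_eq_true'] at hb
  obtain ⟨_, ha, _, ⟨hb, hab, hab'⟩, _, ⟨hc, hbc, hc'⟩, _, ⟨hd, hcd, hd'⟩, rfl⟩ := hb
  obtain ⟨a, hak, rfl⟩ := mem_codedPrefix ha
  obtain ⟨b, hbk, rfl⟩ := mem_codedPrefix hb
  obtain ⟨c, hck, rfl⟩ := mem_codedPrefix hc
  obtain ⟨d, hdk, rfl⟩ := mem_codedPrefix hd
  simp only [codedVertex, disjointBits_bitSum_two_pow, Bool.not_eq_false', decide_eq_true_iff, Nat.blt_eq,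
    mem_nbrsBelow, land_bitSum, Finset.mem_inter,
    Nat.pow_lt_pow_iff_right Nat.one_lt_two] at *
  have hquad : 2 ^ a + 2 ^ b + 2 ^ c + 2 ^ d = bitSum {d, c, b, a} := by
    rw [bitSum_insert, bitSum_insert, bitSum_insert, bitSum_singleton] <;>
    simp only [Finset.mem_insert, Finset.mem_singleton] <;> lia
  rw [hquad, land_bitSum, bitSum_injective.eq_iff, Finset.inter_eq_right] at h
  have hadj : ∀ i ∈ ({d, c, b, a} : Finset ℕ), G.Adj (f k) (f i) := fun i hi =>
    (mem_nbrsBelow.mp (h hi)).2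
  simp only [Finset.mem_insert, Finset.mem_singleton, forall_eq_or_imp, forall_eq] at hadj
  exact containsCopy_top_of_adj hadj.2.2.2 hadj.2.2.1 hadj.2.1 hadj.1 hab'.2 hc'.1.2 hd'.1.1.2
    hc'.2.2 hd'.1.2.2 hd'.2.2

theorem degreeSumBound_le_of_succ {k : ℕ} (hk : k < 9)
    (hmin : ∀ i < k, (nbrsBelow G f (k + 1) k).card ≤ (nbrsBelow G f (k + 1) i).card)
    (h : degreeSumBound (k + 1) ≤ prefixDegreeSum G f (k + 1)) :
    degreeSumBound k ≤ prefixDegreeSum G f k := by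
  have hle : (k + 1) * (nbrsBelow G f k k).card ≤ prefixDegreeSum G f (k + 1) := by
    rw [← nbrsBelow_succ_self, ← smul_eq_mul]
    simpa [prefixDegreeSum] using Finset.card_nsmul_le_sum (Finset.range (k + 1)) _
      (nbrsBelow G f (k + 1) k).card fun i hi => by
        rcases Nat.lt_succ_iff_lt_or_eq.mp (Finset.mem_range.mp hi) with hi | rfl
        · exact hmin i hi
        · exact le_rfl
  rw [prefixDegreeSum_succ] at h hle
  interval_cases k <;> simp [degreeSumBound] at * <;> lia

theorem card_nbrsBelow [DecidableEq V] [DecidableRel G.Adj] {k : ℕ} (hf : Set.InjOn f (Set.Iio k))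
    (i : ℕ) : (nbrsBelow G f k i).card =
      ((Finset.range k).image f |>.filter (G.Adj (f i))).card := by
  rw [Finset.filter_image, Finset.card_image_of_injOn]
  · congr 1
    ext j
    simp [mem_nbrsBelow]
  · exact hf.mono fun j hj => by simpa using (Finset.mem_filter.mp hj).1

theorem exists_minDegree_ordering [Nonempty V] [DecidableEq V] (G : SimpleGraph V) (S : Finset V) :
    ∃ f : ℕ → V, Set.InjOn f (Set.Iio S.card) ∧ (Finset.range S.card).image f = S ∧
      ∀ k < S.card, ∀ i < k,
        (nbrsBelow G f (k + 1) k).card ≤ (nbrsBelow G f (k + 1) i).card := by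
  classical
  induction hn : S.card generalizing S with
  | zero => exact ⟨fun _ => Classical.arbitrary V, by simp, by
      simp [Finset.card_eq_zero.mp hn], by simp⟩
  | succ n ih =>
    obtain ⟨v, hv, hmin⟩ := S.exists_min_image (fun v => (S.filter (G.Adj v)).card)
      (Finset.card_pos.mp (by lia))
    obtain ⟨f, hinj, himage, hf⟩ := ih (S.erase v) (by rw [Finset.card_erase_of_mem hv, hn]; rfl)
    have hlt : ∀ i < n, Function.update f n v i = f i := fun i hi =>
      Function.update_of_ne hi.ne _ _
    have hself : Function.update f n v n = v := Function.update_self _ _ _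
    have himage' : (Finset.range (n + 1)).image (Function.update f n v) = S := by
      rw [Finset.range_add_one, Finset.image_insert, hself,
        Finset.image_congr fun i hi => hlt i (by simpa using hi), himage, Finset.insert_erase hv]
    have hinj' : Set.InjOn (Function.update f n v) (Set.Iio (n + 1)) := by
      have := Finset.card_image_iff.mp
        (show ((Finset.range (n + 1)).image (Function.update f n v)).card =
          (Finset.range (n + 1)).card by rw [himage', hn, Finset.card_range])
      simpa using this
    refine ⟨Function.update f n v, hinj', himage', fun k hk i hi => ?_⟩
    rcases Nat.lt_succ_iff_lt_or_eq.mp hk with hk | rfl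
    · have hcongr : ∀ i ≤ k, nbrsBelow G (Function.update f n v) (k + 1) i =
          nbrsBelow G f (k + 1) i := by
        intro i hi
        ext j
        rw [mem_nbrsBelow, mem_nbrsBelow, hlt i (by lia)]
        exact and_congr_right fun hj => by rw [hlt j (by lia)]
      rw [hcongr k le_rfl, hcongr i hi.le]
      exact hf k hk i hi
    · rw [card_nbrsBelow hinj', card_nbrsBelow hinj', himage', hself]
      refine hmin _ ?_
      rw [← himage']
      exact Finset.mem_image_of_mem _ (Finset.mem_range.mpr (by lia))

theorem mem_codedGraphs (hC : ¬ ContainsCopy cycle6 G)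
    (hK : ¬ ContainsCopy (⊤ : SimpleGraph (Fin 5)) G) {n : ℕ} (hn : n ≤ 9)
    (hf : Set.InjOn f (Set.Iio n))
    (hmin : ∀ k < n, ∀ i < k, (nbrsBelow G f (k + 1) k).card ≤ (nbrsBelow G f (k + 1) i).card)
    (hbound : degreeSumBound n ≤ prefixDegreeSum G f n) :
    (prefixDegreeSum G f n, codedPrefix G f n) ∈ codedGraphs n := by
  induction n with
  | zero => simp [prefixDegreeSum, codedPrefix, codedGraphs]
  | succ n ih =>
    have hmem := ih (by lia) (hf.mono fun i hi => by simp at *; lia)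
      (fun k hk => hmin k (by lia))
      (degreeSumBound_le_of_succ (by lia) (hmin n (by lia)) hbound)
    rw [codedGraphs, List.mem_flatMap]
    refine ⟨_, hmem, ?_⟩
    simp only [codedExtensions, List.mem_filter, List.mem_map, Bool.and_eq_true, Nat.ble_eq]
    refine ⟨⟨((nbrsBelow G f n n).card, bitSum (nbrsBelow G f n n)), ⟨mem_codedSubsets ?_, ?_, ?_⟩,
      ?_⟩, ?_⟩
    · exact fun i hi => Finset.mem_range.mpr (mem_nbrsBelow.mp hi).1
    · rw [← prefixDegreeSum_succ]
      exact hbound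
    · simp only [List.all_eq_true, List.mem_append, Bool.not_eq_true', ← Bool.not_eq_true,
        Nat.beq_eq]
      rintro b (hb | hb) h
      · exact hC (containsCopy_cycle6_of_pathFiveEnds (by lia)
          (hf.mono fun i hi => by simp at *; lia) hb h)
      · exact hK (containsCopy_top_of_fourCliques hb h)
    · rw [← prefixDegreeSum_succ, ← codedPrefix_succ]
    · simp only [codedPrefix, List.range_succ, List.reverse_append, List.reverse_singleton,
        List.singleton_append, List.map_cons, List.all_eq_true, List.mem_map, List.mem_reverse,
        List.mem_range, Nat.ble_eq]
      rintro _ ⟨i, hi, rfl⟩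
      exact hmin n (by lia) i hi

theorem prefixDegreeSum_eq_twice_card_edgeSet [Fintype V]
    (hf : Set.InjOn f (Set.Iio (Fintype.card V)))
    (himage : ∀ v, ∃ i < Fintype.card V, f i = v) :
    prefixDegreeSum G f (Fintype.card V) = 2 * G.edgeSet.ncard := by
  classical
  have hrange : (Finset.range (Fintype.card V)).image f = Finset.univ := by
    ext v
    simpa using himage v
  rw [← SimpleGraph.coe_edgeFinset, Set.ncard_coe_finset, ← G.sum_degrees_eq_twice_card_edges,
    prefixDegreeSum, ← hrange, Finset.sum_image (by simpa using hf)]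
  refine Finset.sum_congr rfl fun i _ => ?_
  rw [card_nbrsBelow hf, hrange, ← SimpleGraph.card_neighborFinset_eq_degree,
    SimpleGraph.neighborFinset_eq_filter]

theorem card_edgeSet_le_of_not_containsCopy [Fintype V] (hV : Fintype.card V = 9)
    (hC : ¬ ContainsCopy cycle6 G) (hK : ¬ ContainsCopy (⊤ : SimpleGraph (Fin 5)) G) :
    G.edgeSet.ncard ≤ 18 := by
  classical
  have : Nonempty V := Fintype.card_pos_iff.mp (by lia)
  obtain ⟨f, hinj, himage, hmin⟩ := exists_minDegree_ordering G Finset.univ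
  rw [Finset.card_univ] at hinj himage hmin
  by_contra! h
  have hsum := prefixDegreeSum_eq_twice_card_edgeSet (G := G) hinj fun v => by
    simpa using Finset.ext_iff.mp himage v
  rw [hV] at hinj hmin hsum
  have := mem_codedGraphs hC hK le_rfl hinj hmin (by rw [hsum]; simp [degreeSumBound]; lia)
  rw [codedGraphs_nine] at this
  exact List.not_mem_nil this

end Ordering

section Winding

open Complex

theorem exists_continuous_exp_eq {X : Type*} [TopologicalSpace X] [SimplyConnectedSpace X]
    [LocallyPathConnectedSpace X] {g : X → ℂ} (hg : Continuous g) (h0 : ∀ x, g x ≠ 0) :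
    ∃ L : X → ℂ, Continuous L ∧ ∀ x, exp (L x) = g x := by
  obtain ⟨x₀⟩ : Nonempty X := inferInstance
  obtain ⟨F, ⟨-, hF⟩, -⟩ := isCoveringMapOn_exp.existsUnique_continuousMap_lifts ⟨g, hg⟩
    (exp_log (h0 x₀)) h0
  exact ⟨F, F.continuous, fun x => congrFun hF x⟩

/-- Two continuous logarithms of functions that differ by a constant factor have the same
increments. -/
theorem sub_eq_sub_of_exp_eq_const_mul {X : Type*} [TopologicalSpace X] [PreconnectedSpace X]
    {L M : X → ℂ} (hL : Continuous L) (hM : Continuous M) {c : ℂ}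
    (h : ∀ x, exp (L x) = c * exp (M x)) (x y : X) : L y - L x = M y - M x := by
  have key : L = fun z => M z + (L x - M x) := by
    refine isCoveringMap_exp.eq_of_comp_eq hL (by fun_prop) ?_ x (by ring)
    ext z
    simp only [Function.comp_apply]
    rw [exp_add, exp_sub, h z, h x, mul_div_cancel_right₀ _ (exp_ne_zero _), mul_comm]
  rw [congrFun key y]
  ring

/-- A continuous choice of a logarithm of `γ t - w`, if there is one. -/
noncomputable def logLift (γ : ℝ → ℂ) (w : ℂ) : ℝ → ℂ :=
  open Classical in
  if h : Continuous γ ∧ ∀ t, γ t - w ≠ 0 then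
    (exists_continuous_exp_eq (h.1.sub continuous_const) h.2).choose
  else 0

/-- The variation of `log (γ t - w)` for `t` from 0 to 1. -/
noncomputable def logVariation (γ : ℝ → ℂ) (w : ℂ) : ℂ := logLift γ w 1 - logLift γ w 0

theorem logVariation_eq {γ : ℝ → ℂ} {w : ℂ} (hγ : Continuous γ) (hw : ∀ t, γ t - w ≠ 0)
    {M : ℝ → ℂ} (hM : Continuous M) {c : ℂ} (h : ∀ t, exp (M t) = c * (γ t - w)) :
    logVariation γ w = M 1 - M 0 := by
  have hlift : Continuous (logLift γ w) ∧ ∀ t, exp (logLift γ w t) = γ t - w := by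
    rw [logLift, dif_pos ⟨hγ, hw⟩]
    exact (exists_continuous_exp_eq (hγ.sub continuous_const) hw).choose_spec
  exact (sub_eq_sub_of_exp_eq_const_mul hM hlift.1 (fun t => by rw [h, hlift.2]) 0 1).symm

theorem exp_logVariation {γ : ℝ → ℂ} {w : ℂ} (hγ : Continuous γ) (hw : ∀ t, γ t - w ≠ 0) :
    exp (logVariation γ w) = (γ 1 - w) / (γ 0 - w) := by
  obtain ⟨L, hL, hexp⟩ :=
    exists_continuous_exp_eq (g := fun t => γ t - w) (hγ.sub continuous_const) hw
  rw [logVariation_eq hγ hw hL (c := 1) (by simpa using hexp), exp_sub, hexp, hexp]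

/-- Going around the boundary of the square, `log (γ s - δ t)` returns to its initial value. -/
theorem logVariation_add_eq_of_disjoint {γ δ : ℝ → ℂ} (hγ : Continuous γ) (hδ : Continuous δ)
    (h : ∀ s t, γ s ≠ δ t) : logVariation γ (δ 0) + logVariation δ (γ 1) =
      logVariation γ (δ 1) + logVariation δ (γ 0) := by
  obtain ⟨L, hL, hexp⟩ := exists_continuous_exp_eq (X := ℝ × ℝ) (g := fun p => γ p.1 - δ p.2)
    (by fun_prop) fun p => sub_ne_zero.mpr (h _ _)
  have hfst : ∀ t, logVariation γ (δ t) = L (1, t) - L (0, t) := fun t =>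
    logVariation_eq hγ (fun s => sub_ne_zero.mpr (h s t)) (M := fun s => L (s, t)) (c := 1)
      (by fun_prop) fun s => by rw [hexp, one_mul]
  have hsnd : ∀ s, logVariation δ (γ s) = L (s, 1) - L (s, 0) := fun s =>
    logVariation_eq hδ (fun t => sub_ne_zero.mpr (h s t).symm) (M := fun t => L (s, t)) (c := -1)
      (by fun_prop) fun t => by rw [hexp]; ring
  rw [hfst, hfst, hsnd, hsnd]
  ring

end Winding

section NonPlanarity

open Complex

/-- There is no drawing of the complete graph on five vertices in the plane in which disjoint
edges do not meet. -/
theorem not_exists_drawing_five (p : Fin 5 → ℂ) (γ : Fin 5 → Fin 5 → ℝ → ℂ)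
    (hcont : ∀ u v, u < v → Continuous (γ u v))
    (hzero : ∀ u v, u < v → γ u v 0 = p u) (hone : ∀ u v, u < v → γ u v 1 = p v)
    (hvertex : ∀ u v w, u < v → w ≠ u → w ≠ v → ∀ t, γ u v t ≠ p w)
    (hedge : ∀ u v x y, u < v → x < y → u ≠ x → u ≠ y → v ≠ x → v ≠ y → ∀ s t,
      γ u v s ≠ γ x y t) : False := by
  let ℓ : Fin 5 → Fin 5 → ℂ := fun u v =>
    if u < v then log (p v - p u) else log (p u - p v) + Real.pi * I
  let σ : Fin 5 → Fin 5 → ℤ := fun u v => if u < v then -1 else 1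
  have hinj : ∀ u v, u ≠ v → p v - p u ≠ 0 := by
    intro u v huv
    obtain ⟨x, hx⟩ : ∃ x, x ≠ u ∧ x ≠ v := by decide +revert
    rcases lt_or_gt_of_ne hx.2 with h | h
    · rw [← hone x v h]
      exact sub_ne_zero.mpr (hvertex x v u h hx.1.symm huv 1)
    · rw [← hzero v x h]
      exact sub_ne_zero.mpr (hvertex v x u h huv hx.1.symm 0)
  have hℓ : ∀ u v, u ≠ v → exp (ℓ u v) = p v - p u := by
    intro u v huv
    simp only [ℓ]
    split_ifs with h
    · exact exp_log (hinj u v huv)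
    · rw [exp_add, exp_log (hinj v u huv.symm), exp_pi_mul_I]
      ring
  have hσ : ∀ u v, u ≠ v → ℓ u v - ℓ v u = σ u v * (Real.pi * I) := by
    intro u v huv
    rcases lt_or_gt_of_ne huv with h | h <;> simp [ℓ, σ, h, h.not_gt]
  have hn : ∀ u v w, ∃ n : ℤ, u < v → w ≠ u → w ≠ v →
      logVariation (γ u v) (p w) = ℓ w v - ℓ w u + n * (2 * Real.pi * I) := by
    intro u v w
    by_cases h : u < v ∧ w ≠ u ∧ w ≠ v
    · obtain ⟨huv, hwu, hwv⟩ := h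
      have hexp : exp (logVariation (γ u v) (p w)) = exp (ℓ w v - ℓ w u) := by
        rw [exp_logVariation (hcont u v huv) fun t => sub_ne_zero.mpr (hvertex u v w huv hwu hwv t),
          hone u v huv, hzero u v huv, exp_sub, hℓ w v hwv, hℓ w u hwu]
      obtain ⟨n, hn⟩ := exp_eq_exp_iff_exists_int.mp hexp
      exact ⟨n, fun _ _ _ => hn⟩
    · exact ⟨0, fun h1 h2 h3 => absurd ⟨h1, h2, h3⟩ h⟩
  choose n hn using hn
  have key : ∀ u v x y, u < v → x < y → u ≠ x → u ≠ y → v ≠ x → v ≠ y →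
      σ x v + σ v y + σ y u + σ u x + 2 * (n u v x + n x y v - n u v y - n x y u) = 0 := by
    intro u v x y huv hxy hux huy hvx hvy
    have h := logVariation_add_eq_of_disjoint (hcont u v huv) (hcont x y hxy)
      (hedge u v x y huv hxy hux huy hvx hvy)
    rw [hzero x y hxy, hone u v huv, hone x y hxy, hzero u v huv, hn u v x huv hux.symm hvx.symm,
      hn x y v hxy hvx hvy, hn u v y huv huy.symm hvy.symm, hn x y u hxy hux huy] at h
    have hcast : ((σ x v + σ v y + σ y u + σ u x + 2 * (n u v x + n x y v - n u v y - n x y u) : ℤ)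
        : ℂ) * (Real.pi * I) = 0 := by
      push_cast
      linear_combination h - hσ x v hvx.symm - hσ v y hvy - hσ y u huy.symm - hσ u x hux
    have hpi : (Real.pi : ℂ) * I ≠ 0 := mul_ne_zero (by exact_mod_cast Real.pi_ne_zero) I_ne_zero
    exact_mod_cast (mul_eq_zero.mp hcast).resolve_right hpi
  have h1 := key 0 1 2 3
  have h2 := key 0 1 2 4
  have h3 := key 0 1 3 4
  have h4 := key 0 2 1 3
  have h5 := key 0 2 1 4
  have h6 := key 0 2 3 4
  have h7 := key 0 3 1 2
  have h8 := key 0 3 1 4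
  have h9 := key 0 3 2 4
  have h10 := key 0 4 1 2
  have h11 := key 0 4 1 3
  have h12 := key 0 4 2 3
  have h13 := key 1 2 3 4
  have h14 := key 1 3 2 4
  have h15 := key 1 4 2 3
  simp [σ] at h1 h2 h3 h4 h5 h6 h7 h8 h9 h10 h11 h12 h13 h14 h15
  lia

theorem not_containsCopy_top_of_hasPlanarEmbedding {V : Type*} {G : SimpleGraph V}
    (hG : G.HasPlanarEmbedding) : ¬ ContainsCopy (⊤ : SimpleGraph (Fin 5)) G := by
  rintro ⟨φ, hφ⟩
  obtain ⟨pos, arc, hpos, harc, hcross⟩ := hG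
  have hadj : ∀ {u v : Fin 5}, u ≠ v → G.Adj (φ u) (φ v) := fun h => φ.map_adj h
  let proj : ℝ → ℝ := fun t => Set.projIcc 0 1 zero_le_one t
  have hproj : ∀ t, proj t ∈ Set.Icc (0 : ℝ) 1 := fun t => (Set.projIcc 0 1 zero_le_one t).2
  have hpoint : ∀ {a b : V}, G.Adj a b → ∀ t ∈ Set.Icc (0 : ℝ) 1,
      arc a b t = pos a ∨ arc a b t = pos b ∨ t ∈ Set.Ioo (0 : ℝ) 1 := by
    intro a b hab t ht
    rcases ht.1.eq_or_lt with rfl | h0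
    · exact Or.inl (harc a b hab).2.2.1
    · rcases ht.2.eq_or_lt with rfl | h1
      · exact Or.inr (Or.inl (harc a b hab).2.2.2.1)
      · exact Or.inr (Or.inr ⟨h0, h1⟩)
  have hvertex : ∀ {a b c : V}, G.Adj a b → c ≠ a → c ≠ b → ∀ t ∈ Set.Icc (0 : ℝ) 1,
      arc a b t ≠ pos c := by
    intro a b c hab hca hcb t ht
    rcases hpoint hab t ht with h | h | h
    · exact h ▸ hpos.ne hca.symm
    · exact h ▸ hpos.ne hcb.symm
    · exact (harc a b hab).2.2.2.2.2 c t h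
  have hedge : ∀ {a b c d : V}, G.Adj a b → G.Adj c d → a ≠ c → a ≠ d → b ≠ c → b ≠ d →
      ∀ s ∈ Set.Icc (0 : ℝ) 1, ∀ t ∈ Set.Icc (0 : ℝ) 1, arc a b s ≠ arc c d t := by
    intro a b c d hab hcd hac had hbc hbd s hs t ht
    rcases hpoint hcd t ht with h | h | h
    · exact h ▸ hvertex hab hac.symm hbc.symm s hs
    · exact h ▸ hvertex hab had.symm hbd.symm s hs
    · rcases hpoint hab s hs with h' | h' | h'
      · exact h' ▸ (hvertex hcd hac had t ht).symm
      · exact h' ▸ (hvertex hcd hbc hbd t ht).symm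
      · refine hcross a b c d hab hcd ?_ s h' t h
        simp [hac, had]
  let E := Complex.equivRealProdCLM.symm
  refine not_exists_drawing_five (fun u => E (pos (φ u))) (fun u v t => E (arc (φ u) (φ v) (proj t)))
    ?_ ?_ ?_ ?_ ?_
  · intro u v huv
    exact E.continuous.comp (((harc _ _ (hadj huv.ne)).1.comp_continuous
      (continuous_subtype_val.comp continuous_projIcc)) hproj)
  · intro u v huv
    simp [proj, (harc _ _ (hadj huv.ne)).2.2.1]
  · intro u v huv
    simp [proj, (harc _ _ (hadj huv.ne)).2.2.2.1]
  · intro u v w huv hwu hwv t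
    exact E.injective.ne (hvertex (hadj huv.ne) (hφ.ne hwu) (hφ.ne hwv) _ (hproj t))
  · intro u v x y huv hxy hux huy hvx hvy s t
    exact E.injective.ne (hedge (hadj huv.ne) (hadj hxy.ne) (hφ.ne hux) (hφ.ne huy) (hφ.ne hvx)
      (hφ.ne hvy) _ (hproj s) _ (hproj t))

end NonPlanarity

section StraightLineDrawing

/-- Twice the signed area of the triangle with vertices `p`, `q`, `r`. -/
def signedArea {R : Type*} [CommRing R] (p q r : R × R) : R :=
  (q.1 - p.1) * (r.2 - p.2) - (q.2 - p.2) * (r.1 - p.1)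

theorem signedArea_add_smul {R : Type*} [CommRing R] (p q a b : R × R) (t : R) :
    signedArea p q ((1 - t) • a + t • b) =
      (1 - t) * signedArea p q a + t * signedArea p q b := by
  simp [signedArea]
  ring

theorem signedArea_left {R : Type*} [CommRing R] (p q : R × R) : signedArea p q p = 0 := by
  simp [signedArea]

theorem signedArea_right {R : Type*} [CommRing R] (p q : R × R) : signedArea p q q = 0 := by
  simp [signedArea, mul_comm]

theorem signedArea_intCast {R : Type*} [CommRing R] (p q r : ℤ × ℤ) :
    signedArea (Prod.map Int.cast Int.cast p) (Prod.map Int.cast Int.cast q)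
      (Prod.map Int.cast Int.cast r) = ((signedArea p q r : ℤ) : R) := by
  simp [signedArea]

/-- The points `a` and `b` lie in the same closed half-plane bounded by the line `pq`, and not
both on that line. -/
def SameSide (p q a b : ℤ × ℤ) : Prop :=
  0 ≤ signedArea p q a * signedArea p q b ∧ (signedArea p q a ≠ 0 ∨ signedArea p q b ≠ 0)

instance (p q a b : ℤ × ℤ) : Decidable (SameSide p q a b) := inferInstanceAs (Decidable (_ ∧ _))

theorem SameSide.signedArea_ne_zero {p q a b : ℤ × ℤ} (h : SameSide p q a b) {t : ℝ}
    (ht : t ∈ Set.Ioo (0 : ℝ) 1) :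
    (1 - t) * ((signedArea p q a : ℤ) : ℝ) + t * ((signedArea p q b : ℤ) : ℝ) ≠ 0 := by
  obtain ⟨hmul, hne⟩ := h
  generalize signedArea p q a = m at hmul hne
  generalize signedArea p q b = n at hmul hne
  have hmul' : (0 : ℝ) ≤ m * n := by exact_mod_cast hmul
  have h0 := ht.1
  have h1 : 0 < 1 - t := sub_pos.mpr ht.2
  intro h
  have hm : (m : ℝ) * ((1 - t) * m + t * n) = 0 := by rw [h, mul_zero]
  have hn : (n : ℝ) * ((1 - t) * m + t * n) = 0 := by rw [h, mul_zero]
  have h2 := mul_nonneg h0.le hmul'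
  have h3 := mul_nonneg h1.le hmul'
  rcases hne with hne | hne
  · have : 0 < (1 - t) * ((m : ℝ) * m) := mul_pos h1 (mul_self_pos.mpr (by exact_mod_cast hne))
    linarith
  · have : 0 < t * ((n : ℝ) * n) := mul_pos h0 (mul_self_pos.mpr (by exact_mod_cast hne))
    linarith

theorem hasPlanarEmbedding_of_sameSide {V : Type*} {G : SimpleGraph V} (p : V → ℤ × ℤ)
    (hp : Function.Injective p)
    (hvertex : ∀ u v w, G.Adj u v → w ≠ u → w ≠ v → signedArea (p u) (p v) (p w) ≠ 0)
    (hedge : ∀ u v x y, G.Adj u v → G.Adj x y → s(u, v) ≠ s(x, y) →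
      SameSide (p x) (p y) (p u) (p v) ∨ SameSide (p u) (p v) (p x) (p y)) :
    G.HasPlanarEmbedding := by
  let pos : V → ℝ × ℝ := fun v => Prod.map Int.cast Int.cast (p v)
  have hpos : Function.Injective pos :=
    (Prod.map_injective.mpr ⟨Int.cast_injective, Int.cast_injective⟩).comp hp
  have hinj : ∀ u v, u ≠ v → Function.Injective fun t : ℝ => (1 - t) • pos u + t • pos v := by
    intro u v huv s t hst
    have h : (s - t) • (pos v - pos u) = 0 := by
      rw [← sub_eq_zero.mpr hst]
      module
    exact sub_eq_zero.mp ((smul_eq_zero.mp h).resolve_right (sub_ne_zero.mpr (hpos.ne huv.symm)))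
  refine ⟨pos, fun u v t => (1 - t) • pos u + t • pos v, hpos, fun u v huv => ⟨by fun_prop,
    (hinj u v huv.ne).injOn, by simp, by simp, fun t => by module, fun w t ht h => ?_⟩, ?_⟩
  · by_cases hu : w = u
    · subst hu
      exact ht.1.ne' (hinj w v huv.ne (by simpa using h))
    by_cases hv : w = v
    · subst hv
      exact ht.2.ne (hinj u w huv.ne (by simpa using h))
    have harea := congrArg (signedArea (pos u) (pos v)) h
    rw [signedArea_add_smul, signedArea_left, signedArea_right, signedArea_intCast] at harea
    refine hvertex u v w huv hu hv ?_
    simpa using harea.symm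
  · intro u v x y huv hxy hne t₁ ht₁ t₂ ht₂ h
    rcases hedge u v x y huv hxy hne with hs | hs
    · have harea := congrArg (signedArea (pos x) (pos y)) h
      simp only [signedArea_add_smul, signedArea_left, signedArea_right] at harea
      rw [signedArea_intCast, signedArea_intCast] at harea
      exact hs.signedArea_ne_zero ht₁ (by simpa using harea)
    · have harea := congrArg (signedArea (pos u) (pos v)) h.symm
      simp only [signedArea_add_smul, signedArea_left, signedArea_right] at harea
      rw [signedArea_intCast, signedArea_intCast] at harea
      exact hs.signedArea_ne_zero ht₂ (by simpa using harea)

end StraightLineDrawing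

section TwoCopies

/-- Two copies of `K₅⁻`, on `{0, 1, 2, 3, 4}` and `{0, 5, 6, 7, 8}`, that share the vertex 0; the
missing edges are `04` and `08`. -/
def twoK5minus : SimpleGraph (Fin 9) :=
  SimpleGraph.fromRel fun u v => u < v ∧ (v ≤ 4 ∨ u = 0 ∨ 5 ≤ u) ∧ (u, v) ≠ (0, 4) ∧ (u, v) ≠ (0, 8)

instance : DecidableRel twoK5minus.Adj := fun _ _ => decidable_of_iff _ (SimpleGraph.fromRel_adj ..).symm

/-- The points of a straight-line drawing of `twoK5minus`, one copy in each half-plane. -/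
def twoK5minusPoint : Fin 9 → ℤ × ℤ :=
  ![(0, 0), (-12, 20), (13, 21), (1, 8), (0, 16), (-11, -19), (12, -23), (1, -9), (-1, -17)]

theorem hasPlanarEmbedding_twoK5minus : twoK5minus.HasPlanarEmbedding :=
  hasPlanarEmbedding_of_sameSide twoK5minusPoint (by decide +kernel) (by decide +kernel)
    (by
      have : ∀ u v, twoK5minus.Adj u v → ∀ x y, twoK5minus.Adj x y → s(u, v) ≠ s(x, y) →
          SameSide (twoK5minusPoint x) (twoK5minusPoint y) (twoK5minusPoint u) (twoK5minusPoint v) ∨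
          SameSide (twoK5minusPoint u) (twoK5minusPoint v) (twoK5minusPoint x)
            (twoK5minusPoint y) := by
        decide +kernel
      exact fun u v x y huv hxy => this u v huv x y hxy)

theorem not_containsCopy_cycle6_twoK5minus : ¬ ContainsCopy cycle6 twoK5minus := by
  rintro ⟨φ, hφ⟩
  have h : ∀ a b, twoK5minus.Adj a b → ∀ c, twoK5minus.Adj b c → a ≠ c →
      ∀ d, twoK5minus.Adj c d → a ≠ d → b ≠ d → ∀ e, twoK5minus.Adj d e → a ≠ e → b ≠ e → c ≠ e →
      ∀ x, twoK5minus.Adj e x → b ≠ x → c ≠ x → d ≠ x → ¬ twoK5minus.Adj a x := by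
    decide +kernel
  have hadj : ∀ i j, i ≠ j → s(i, j) ∈ ({s(0, 1), s(1, 2), s(2, 3), s(3, 4), s(4, 5), s(0, 5)} :
      Set (Sym2 (Fin 6))) → twoK5minus.Adj (φ i) (φ j) := fun i j hij hmem =>
    φ.map_adj ((SimpleGraph.fromEdgeSet_adj _).mpr ⟨hmem, hij⟩)
  exact h (φ 0) (φ 1) (hadj _ _ (by decide) (by simp)) (φ 2) (hadj _ _ (by decide) (by simp))
    (hφ.ne (by decide)) (φ 3) (hadj _ _ (by decide) (by simp)) (hφ.ne (by decide))
    (hφ.ne (by decide)) (φ 4) (hadj _ _ (by decide) (by simp)) (hφ.ne (by decide))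
    (hφ.ne (by decide)) (hφ.ne (by decide)) (φ 5) (hadj _ _ (by decide) (by simp))
    (hφ.ne (by decide)) (hφ.ne (by decide)) (hφ.ne (by decide)) (hadj _ _ (by decide) (by simp))

theorem ncard_edgeSet_twoK5minus : twoK5minus.edgeSet.ncard = 18 := by
  rw [← SimpleGraph.coe_edgeFinset, Set.ncard_coe_finset]
  have h := twoK5minus.sum_degrees_eq_twice_card_edges
  have h' : ∑ v, twoK5minus.degree v = 36 := by decide +kernel
  lia

end TwoCopies

/-- There is a planar, `C₆`-free simple graph on 9 vertices with 18 edges; together with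
the upper bound at `n = 9` this gives `ex_P(9, C₆) = 18 = 18(9-2)/7`. -/
theorem planar_turan_c6_nine :
    (∃ G : SimpleGraph (Fin 9), G.HasPlanarEmbedding ∧ ¬ ContainsCopy cycle6 G ∧
      G.edgeSet.ncard = 18) ∧
    (∀ (V : Type) [Fintype V] (G : SimpleGraph V), Fintype.card V = 9 →
      G.HasPlanarEmbedding → ¬ ContainsCopy cycle6 G → G.edgeSet.ncard ≤ 18) :=
  ⟨⟨twoK5minus, hasPlanarEmbedding_twoK5minus, not_containsCopy_cycle6_twoK5minus,
    ncard_edgeSet_twoK5minus⟩, fun _ _ _ hV hG hC =>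
    card_edgeSet_le_of_not_containsCopy hV hC (not_containsCopy_top_of_hasPlanarEmbedding hG)⟩
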